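/- arXiv:1711.11550 — 5 statements merged into one kernel-verified Lean document; each statement's English description precedes it below -/
import Mathlib

section
/- (Conservation over coarser decompositions.) For every vector v ∈ ℝ^{n_u N_Ω}, if C̄ v = 0 then C̄̄ v = 0. In particular, if a vector of the form v = α x' − f (e.g., a finite-volume ODE or linear-multistep residual) satisfies conservation over the decomposed mesh {Ω̄_m}, then it satisfies conservation over the coarser decomposed mesh {Ω̄̄_j}. -/
open MeasureTheory

/-- A set of positive measure covered by countably many members of an almost disjoint family
to which it belongs is one of the covering members. -/
theorem mem_of_subset_biUnion_of_aedisjoint {X ι : Type*} [MeasurableSpace X] {μ : Measure X}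
    {K : ι → Set X} (hdisj : ∀ k k', k ≠ k' → μ (K k ∩ K k') = 0) {k : ι}
    (hpos : 0 < μ (K k)) {T : Set ι} (hT : T.Countable) (h : K k ⊆ ⋃ k' ∈ T, K k') : k ∈ T := by
  by_contra hk
  refine hpos.ne' (measure_mono_null (t := ⋃ k' ∈ T, K k ∩ K k') ?_ ?_)
  · rw [← Set.inter_iUnion₂]
    exact Set.subset_inter subset_rfl h
  · exact (measure_biUnion_null_iff hT).2 fun k' hk' =>
      hdisj k k' fun e => hk (e ▸ hk')

open Classical in
/-- A row of an averaging matrix computes the average over the corresponding subdomain. -/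
theorem averaging_mulVec_apply {X ι κ η : Type*} [Fintype κ] [Fintype η] [DecidableEq η]
    [MeasurableSpace X]
    (μ : Measure X) (K : κ → Set X) (Ω : ι → Set X) (C : Matrix (η × ι) (η × κ) ℝ)
    (hC : ∀ i j l k, C (i, j) (l, k) =
      (if i = l then (1 : ℝ) else 0) * ((μ (K k)).toReal / (μ (Ω j)).toReal) *
        (if K k ⊆ Ω j then (1 : ℝ) else 0)) (v : η × κ → ℝ) (i : η) (j : ι) :
    C.mulVec v (i, j) =
      (∑ k, (if K k ⊆ Ω j then (1 : ℝ) else 0) * ((μ (K k)).toReal * v (i, k))) /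
        (μ (Ω j)).toReal := by
  rw [Matrix.mulVec, dotProduct, Fintype.sum_prod_type, Finset.sum_eq_single i]
  · rw [Finset.sum_div]
    refine Finset.sum_congr rfl fun k _ => ?_
    rw [hC, if_pos rfl]
    ring
  · intro l _ hl
    refine Finset.sum_eq_zero fun k _ => ?_
    rw [hC, if_neg (Ne.symm hl)]
    ring
  · simp

open Classical in
/-- Conservation over coarser decompositions: if `C̄ v = 0` then `C̄̄ v = 0`. -/
theorem conservation_over_coarser_decompositions
    {X : Type*} [MeasurableSpace X] (μ : Measure X)
    (NΩ N1 N2 : ℕ)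
    (K : Fin NΩ → Set X) (hKmeas : ∀ k, MeasurableSet (K k))
    (hKpos : ∀ k, 0 < μ (K k)) (hKfin : ∀ k, μ (K k) < ⊤)
    (hKdisj : ∀ k k', k ≠ k' → μ (K k ∩ K k') = 0)
    (S : Fin N1 → Finset (Fin NΩ)) (hS : ∀ m, (S m).Nonempty)
    (Ω1 : Fin N1 → Set X) (hΩ1 : ∀ m, Ω1 m = ⋃ k ∈ S m, K k)
    (hΩ1disj : ∀ m m', m ≠ m' → μ (Ω1 m ∩ Ω1 m') = 0)
    (B : Fin N2 → Finset (Fin N1)) (hB : ∀ j, (B j).Nonempty)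
    (Ω2 : Fin N2 → Set X) (hΩ2 : ∀ j, Ω2 j = ⋃ m ∈ B j, Ω1 m)
    (nu : ℕ) (hnu : 1 ≤ nu)
    (C1 : Matrix (Fin nu × Fin N1) (Fin nu × Fin NΩ) ℝ)
    (hC1 : ∀ (i : Fin nu) (j : Fin N1) (l : Fin nu) (kk : Fin NΩ),
      C1 (i, j) (l, kk) =
        (if i = l then (1 : ℝ) else 0) * ((μ (K kk)).toReal / (μ (Ω1 j)).toReal) *
          (if K kk ⊆ Ω1 j then (1 : ℝ) else 0))
    (C2 : Matrix (Fin nu × Fin N2) (Fin nu × Fin NΩ) ℝ)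
    (hC2 : ∀ (i : Fin nu) (j : Fin N2) (l : Fin nu) (kk : Fin NΩ),
      C2 (i, j) (l, kk) =
        (if i = l then (1 : ℝ) else 0) * ((μ (K kk)).toReal / (μ (Ω2 j)).toReal) *
          (if K kk ⊆ Ω2 j then (1 : ℝ) else 0)) :
    ∀ v : Fin nu × Fin NΩ → ℝ, C1.mulVec v = 0 → C2.mulVec v = 0 := by
  intro v hv
  have hmoment : ∀ i m,
      ∑ k, (if K k ⊆ Ω1 m then (1 : ℝ) else 0) * ((μ (K k)).toReal * v (i, k)) = 0 := by
    intro i m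
    have h := congrFun hv (i, m)
    rw [averaging_mulVec_apply μ K Ω1 C1 hC1, Pi.zero_apply, div_eq_zero_iff] at h
    refine h.resolve_right (ENNReal.toReal_pos ?_ ?_).ne'
    · obtain ⟨k, hk⟩ := hS m
      have hsub : K k ⊆ Ω1 m := by
        rw [hΩ1]
        exact Set.subset_biUnion_of_mem (u := K) hk
      exact ((hKpos k).trans_le (measure_mono hsub)).ne'
    · rw [hΩ1]
      exact (measure_biUnion_lt_top (S m).finite_toSet fun k _ => hKfin k).ne
  have hindicator : ∀ j k, (if K k ⊆ Ω2 j then (1 : ℝ) else 0) =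
      ∑ m ∈ B j, if K k ⊆ Ω1 m then (1 : ℝ) else 0 := by
    intro j k
    have hsub : ∀ m ∈ B j, Ω1 m ⊆ Ω2 j := fun m hm => by
      rw [hΩ2]
      exact Set.subset_biUnion_of_mem (u := Ω1) hm
    split_ifs with h
    · have hcover : K k ⊆ ⋃ k' ∈ {k' | ∃ m ∈ B j, k' ∈ S m}, K k' := by
        intro x hx
        have hx2 := h hx
        simp only [hΩ2, hΩ1, Set.mem_iUnion, exists_prop] at hx2
        obtain ⟨m, hm, k', hk', hxk'⟩ := hx2
        exact Set.mem_biUnion (show k' ∈ {k' | ∃ m ∈ B j, k' ∈ S m} from ⟨m, hm, hk'⟩) hxk'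
      obtain ⟨m, hm, hk⟩ := mem_of_subset_biUnion_of_aedisjoint hKdisj (hKpos k)
        (Set.to_countable _) hcover
      have hkm : K k ⊆ Ω1 m := by
        rw [hΩ1]
        exact Set.subset_biUnion_of_mem (u := K) hk
      rw [Finset.sum_eq_single_of_mem m hm, if_pos hkm]
      intro m' _ hne
      refine if_neg fun hkm' => (hKpos k).ne' ?_
      exact measure_mono_null (Set.subset_inter hkm' hkm) (hΩ1disj m' m hne)
    · exact (Finset.sum_eq_zero fun m hm => if_neg fun hkm => h (hkm.trans (hsub m hm))).symm
  ext ⟨i, j⟩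
  rw [averaging_mulVec_apply μ K Ω2 C2 hC2, Pi.zero_apply]
  simp_rw [hindicator, Finset.sum_mul]
  rw [Finset.sum_comm, Finset.sum_eq_zero fun m _ => hmoment i m, zero_div]
end

section
/- (Conservative Galerkin solution as orthogonal projection onto the feasible set.) Let f ∈ ℝ^N and suppose the feasible set S := { w ∈ ℝ^p : C̄Φw = C̄f } is nonempty. Then the unique minimizer of w ↦ ‖Φw − f‖ over S coincides with the unique minimizer of w ↦ ‖w − Φᵀ f‖ over S; that is, the conservative Galerkin solution is the orthogonal projection of the standard Galerkin velocity Φᵀ f onto the feasible set S. -/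
open Matrix

noncomputable def euclNorm {n : ℕ} (v : Fin n → ℝ) : ℝ := Real.sqrt (∑ i, v i ^ 2)

theorem euclNorm_eq_norm_toLp {n : ℕ} (v : Fin n → ℝ) : euclNorm v = ‖WithLp.toLp 2 v‖ := by
  simp [euclNorm, EuclideanSpace.norm_eq]

theorem euclNorm_le_euclNorm_iff {m n : ℕ} (v : Fin m → ℝ) (w : Fin n → ℝ) :
    euclNorm v ≤ euclNorm w ↔ v ⬝ᵥ v ≤ w ⬝ᵥ w := by
  simp only [euclNorm, dotProduct, ← pow_two]
  exact Real.sqrt_le_sqrt_iff (Finset.sum_nonneg fun i _ => sq_nonneg (w i))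

/-- Pythagoras for a matrix with orthonormal columns. -/
theorem dotProduct_self_mulVec_sub {m n : Type*} [Fintype m] [Fintype n] [DecidableEq n]
    (A : Matrix m n ℝ) (hA : Aᵀ * A = 1) (f : m → ℝ) (w : n → ℝ) :
    (A *ᵥ w - f) ⬝ᵥ (A *ᵥ w - f) =
      (w - Aᵀ *ᵥ f) ⬝ᵥ (w - Aᵀ *ᵥ f) + (f ⬝ᵥ f - (Aᵀ *ᵥ f) ⬝ᵥ (Aᵀ *ᵥ f)) := by
  have h1 : (A *ᵥ w) ⬝ᵥ (A *ᵥ w) = w ⬝ᵥ w := by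
    rw [dotProduct_mulVec, ← mulVec_transpose, mulVec_mulVec, hA, one_mulVec]
  have h2 : f ⬝ᵥ (A *ᵥ w) = (Aᵀ *ᵥ f) ⬝ᵥ w := by
    rw [dotProduct_mulVec, mulVec_transpose]
  simp only [sub_dotProduct, dotProduct_sub, h1, dotProduct_comm (A *ᵥ w) f, h2,
    dotProduct_comm w (Aᵀ *ᵥ f)]
  ring

theorem euclNorm_mulVec_sub_le_iff {m n : ℕ} (A : Matrix (Fin m) (Fin n) ℝ) (hA : Aᵀ * A = 1)
    (f : Fin m → ℝ) (v w : Fin n → ℝ) :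
    euclNorm (A *ᵥ v - f) ≤ euclNorm (A *ᵥ w - f) ↔
      euclNorm (v - Aᵀ *ᵥ f) ≤ euclNorm (w - Aᵀ *ᵥ f) := by
  simp only [euclNorm_le_euclNorm_iff, dotProduct_self_mulVec_sub A hA, add_le_add_iff_right]

theorem existsUnique_euclNorm_sub_le {n : ℕ} {S : Set (Fin n → ℝ)} (hne : S.Nonempty)
    (hclosed : IsClosed S) (hconvex : Convex ℝ S) (g : Fin n → ℝ) :
    ∃! v : Fin n → ℝ, v ∈ S ∧ ∀ w ∈ S, euclNorm (v - g) ≤ euclNorm (w - g) := by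
  have hclosed' : IsClosed ((WithLp.ofLp : EuclideanSpace ℝ (Fin n) → _) ⁻¹' S) :=
    hclosed.preimage (PiLp.continuous_ofLp 2 _)
  obtain ⟨x, hx⟩ := hne
  obtain ⟨y, hyS, hy⟩ := hclosed'.exists_infDist_eq_dist ⟨WithLp.toLp 2 x, hx⟩ (WithLp.toLp 2 g)
  obtain ⟨v, hvS, hv⟩ : ∃ v ∈ S, ∀ w ∈ S, euclNorm (v - g) ≤ euclNorm (w - g) := by
    refine ⟨WithLp.ofLp y, hyS, fun w hw => ?_⟩
    have h := Metric.infDist_le_dist_of_mem (x := WithLp.toLp 2 g)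
      (show WithLp.toLp 2 w ∈ (WithLp.ofLp : EuclideanSpace ℝ (Fin n) → _) ⁻¹' S from hw)
    rw [hy, dist_comm, dist_comm _ (WithLp.toLp 2 w), dist_eq_norm, dist_eq_norm] at h
    simpa [euclNorm_eq_norm_toLp] using h
  refine ⟨v, ⟨hvS, hv⟩, ?_⟩
  rintro u ⟨huS, hu⟩
  have hm : (1 / 2 : ℝ) • u + (1 / 2 : ℝ) • v ∈ S :=
    hconvex huS hvS (by norm_num) (by norm_num) (by norm_num)
  have h1 := (euclNorm_le_euclNorm_iff _ _).1 (hu _ hm)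
  have h2 := (euclNorm_le_euclNorm_iff _ _).1 (hv _ hm)
  have parallelogram : (u - v) ⬝ᵥ (u - v) =
      2 * ((u - g) ⬝ᵥ (u - g)) + 2 * ((v - g) ⬝ᵥ (v - g)) -
      4 * (((1 / 2 : ℝ) • u + (1 / 2 : ℝ) • v - g) ⬝ᵥ
        ((1 / 2 : ℝ) • u + (1 / 2 : ℝ) • v - g)) := by
    simp only [sub_dotProduct, dotProduct_sub, add_dotProduct, dotProduct_add, smul_dotProduct,
      dotProduct_smul, smul_eq_mul, dotProduct_comm v u, dotProduct_comm g u, dotProduct_comm g v]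
    ring
  have hnonneg : 0 ≤ (u - v) ⬝ᵥ (u - v) := Finset.sum_nonneg fun i _ => mul_self_nonneg _
  exact sub_eq_zero.1 (dotProduct_self_eq_zero.1 (by linarith))

/-- The conservative Galerkin solution is the orthogonal projection of the
standard Galerkin velocity `Φᵀ f` onto the feasible set. -/
theorem conservative_galerkin_orthogonal_projection
    (N Nb p : ℕ) (hN : 0 < N) (hNb : 0 < Nb) (hp : 0 < p)
    (Φ : Matrix (Fin N) (Fin p) ℝ) (hΦ : Φᵀ * Φ = 1)
    (C : Matrix (Fin Nb) (Fin N) ℝ) (f : Fin N → ℝ)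
    (S : Set (Fin p → ℝ))
    (hSdef : S = {w : Fin p → ℝ | (C * Φ).mulVec w = C.mulVec f})
    (hfeas : S.Nonempty) :
    (∃! v : Fin p → ℝ, v ∈ S ∧
        ∀ w ∈ S, euclNorm (Φ.mulVec v - f) ≤ euclNorm (Φ.mulVec w - f)) ∧
    (∃! v : Fin p → ℝ, v ∈ S ∧
        ∀ w ∈ S, euclNorm (v - Φᵀ.mulVec f) ≤ euclNorm (w - Φᵀ.mulVec f)) ∧
    (∀ v ∈ S,
      ((∀ w ∈ S, euclNorm (Φ.mulVec v - f) ≤ euclNorm (Φ.mulVec w - f)) ↔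
        (∀ w ∈ S, euclNorm (v - Φᵀ.mulVec f) ≤ euclNorm (w - Φᵀ.mulVec f)))) := by
  simp only [euclNorm_mulVec_sub_le_iff Φ hΦ]
  have hclosed : IsClosed S := by
    rw [hSdef]
    exact isClosed_eq (Continuous.matrix_mulVec continuous_const continuous_id) continuous_const
  have hconvex : Convex ℝ S := by
    rw [hSdef]
    intro x hx y hy a b _ _ hab
    simp only [Set.mem_ofPred_eq] at hx hy ⊢
    rw [mulVec_add, mulVec_smul, mulVec_smul, hx, hy, ← add_smul, hab, one_smul]
  have h := existsUnique_euclNorm_sub_le hfeas hclosed hconvex (Φᵀ *ᵥ f)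
  exact ⟨h, h, by simp⟩
end

section
/- (Commutativity of conservative Galerkin projection and time discretization.) Assume the consistency condition Σ_{j=0}^k α_j = 0. Then for all reduced states x̂^n,…,x̂^{n−k} ∈ ℝ^p and Lagrange multipliers λ^n,…,λ^{n−k} ∈ ℝ^{N̄}, the following two systems of equations are equivalent: (i) Σ_{j=0}^k α_j x̂^{n−j} + Σ_{j=0}^k α_j Φᵀ C̄ᵀ λ^{n−j} = Δt Σ_{j=0}^k β_j Φᵀ f(x_0 + Φ x̂^{n−j}, t^{n−j}) together with Σ_{j=0}^k α_j C̄ Φ x̂^{n−j} = Δt Σ_{j=0}^k β_j C̄ f(x_0 + Φ x̂^{n−j}, t^{n−j}); and (ii) Φᵀ [ Σ_{j=0}^k α_j (x_0 + Φ x̂^{n−j}) + Σ_{j=0}^k α_j C̄ᵀ λ^{n−j} − Δt Σ_{j=0}^k β_j f(x_0 + Φ x̂^{n−j}, t^{n−j}) ] = 0 together with C̄ [ Σ_{j=0}^k α_j (x_0 + Φ x̂^{n−j}) − Δt Σ_{j=0}^k β_j f(x_0 + Φ x̂^{n−j}, t^{n−j}) ] = 0. That is, applying the linear multistep scheme to the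 conservative Galerkin saddle-point ODE yields the same discrete system as applying conservative Galerkin projection to the linear-multistep discretization of the full joint saddle-point system. -/
open Matrix Finset

/-- A consistent linear combination annihilates a constant offset. -/
theorem sum_smul_const_add {ι R M : Type*} [Ring R] [AddCommGroup M] [Module R M]
    {s : Finset ι} {a : ι → R} (ha : ∑ j ∈ s, a j = 0) (c : M) (v : ι → M) :
    ∑ j ∈ s, a j • (c + v j) = ∑ j ∈ s, a j • v j := by
  simp_rw [smul_add, Finset.sum_add_distrib, ← Finset.sum_smul, ha, zero_smul, zero_add]

/-- Matrix-vector multiplication commutes with finite linear combinations. -/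
theorem mulVec_sum_smul {ι m n R : Type*} [Fintype n] [CommSemiring R]
    (A : Matrix m n R) (s : Finset ι) (a : ι → R) (v : ι → n → R) :
    A.mulVec (∑ j ∈ s, a j • v j) = ∑ j ∈ s, a j • A.mulVec (v j) := by
  simp_rw [← Matrix.mulVecLin_apply, map_sum, map_smul]

/-- Commutativity of conservative Galerkin projection and time discretization:
applying a linear multistep scheme to the conservative Galerkin saddle-point ODE
yields the same discrete system as applying conservative Galerkin projection to
the linear-multistep discretization of the full joint saddle-point system. -/
theorem conservative_galerkin_commutes_with_time_discretization
    (N Nb p k : ℕ) (hN : 0 < N) (hNb : 0 < Nb) (hp : 0 < p) (hk : 1 ≤ k)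
    (Φ : Matrix (Fin N) (Fin p) ℝ) (hΦ : Φᵀ * Φ = 1)
    (C : Matrix (Fin Nb) (Fin N) ℝ)
    (Δt : ℝ) (hΔt : 0 < Δt)
    (α β : ℕ → ℝ)
    (hconsist : ∑ j ∈ Finset.range (k + 1), α j = 0)
    (t : ℕ → ℝ) (x0 : Fin N → ℝ)
    (f : (Fin N → ℝ) → ℝ → (Fin N → ℝ))
    (xh : ℕ → Fin p → ℝ) (lam : ℕ → Fin Nb → ℝ) :
    -- (i) linear multistep scheme applied to the conservative Galerkin
    --     saddle-point ODE
    ((∑ j ∈ Finset.range (k + 1), α j • xh j)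
        + (∑ j ∈ Finset.range (k + 1), α j • (Φᵀ * Cᵀ).mulVec (lam j))
      = Δt • ∑ j ∈ Finset.range (k + 1),
          β j • Φᵀ.mulVec (f (x0 + Φ.mulVec (xh j)) (t j)) ∧
     (∑ j ∈ Finset.range (k + 1), α j • (C * Φ).mulVec (xh j))
      = Δt • ∑ j ∈ Finset.range (k + 1),
          β j • C.mulVec (f (x0 + Φ.mulVec (xh j)) (t j)))
    ↔
    -- (ii) conservative Galerkin projection applied to the linear-multistep
    --      discretization of the full joint saddle-point system
    (Φᵀ.mulVec ((∑ j ∈ Finset.range (k + 1), α j • (x0 + Φ.mulVec (xh j)))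
        + (∑ j ∈ Finset.range (k + 1), α j • Cᵀ.mulVec (lam j))
        - Δt • ∑ j ∈ Finset.range (k + 1),
            β j • f (x0 + Φ.mulVec (xh j)) (t j)) = 0 ∧
     C.mulVec ((∑ j ∈ Finset.range (k + 1), α j • (x0 + Φ.mulVec (xh j)))
        - Δt • ∑ j ∈ Finset.range (k + 1),
            β j • f (x0 + Φ.mulVec (xh j)) (t j)) = 0) := by
  rw [sum_smul_const_add hconsist]
  simp only [Matrix.mulVec_sub, Matrix.mulVec_add, Matrix.mulVec_smul, mulVec_sum_smul,
    Matrix.mulVec_mulVec, hΦ, Matrix.one_mulVec, sub_eq_zero]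
end

section
/- (Sufficient condition for feasibility of conservative LSPG projection: explicit scheme.) Assume the scheme is explicit, i.e., β_0 = 0, and that α_0 ≠ 0. Given arbitrary previous reduced states x̂^{n−1},…,x̂^{n−k} ∈ ℝ^p, define the linear-multistep residual R(w) := α_0 Φ w − Δt β_0 f(x_0 + Φw, t^n) + Σ_{j=1}^k ( α_j Φ x̂^{n−j} − Δt β_j f(x_0 + Φ x̂^{n−j}, t^{n−j}) ). If rank(C̄Φ) = N̄, then there exists w ∈ ℝ^p with C̄ R(w) = 0; i.e., the conservative LSPG feasible set is nonempty. -/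
open Matrix Finset

/-- A matrix over a field whose rank equals its number of rows acts surjectively on vectors. -/
theorem mulVec_surjective_of_rank_eq_card {K m n : Type*} [Field K] [Fintype m] [Fintype n]
    (A : Matrix m n K) (hA : A.rank = Fintype.card m) : Function.Surjective A.mulVec := by
  have hrange : LinearMap.range A.mulVecLin = ⊤ := by
    apply Submodule.eq_top_of_finrank_eq
    rw [Module.finrank_fintype_fun_eq_card, ← hA, Matrix.rank]
  exact LinearMap.range_eq_top.mp hrange

/-- Sufficient condition for feasibility of conservative LSPG projection with an
explicit scheme: if `β₀ = 0`, `α₀ ≠ 0`, and `C̄Φ` has full row rank, then the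
conservative LSPG feasible set is nonempty. -/
theorem conservative_lspg_feasibility_explicit
    (N Nb p k : ℕ) (hN : 0 < N) (hNb : 0 < Nb) (hp : 0 < p) (hk : 1 ≤ k)
    (Φ : Matrix (Fin N) (Fin p) ℝ) (hΦ : Φᵀ * Φ = 1)
    (C : Matrix (Fin Nb) (Fin N) ℝ)
    (Δt : ℝ) (hΔt : 0 < Δt)
    (α β : ℕ → ℝ) (hβ0 : β 0 = 0) (hα0 : α 0 ≠ 0)
    (t : ℕ → ℝ) (x0 : Fin N → ℝ)
    (f : (Fin N → ℝ) → ℝ → (Fin N → ℝ))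
    (xh : ℕ → Fin p → ℝ)
    (R : (Fin p → ℝ) → (Fin N → ℝ))
    (hR : ∀ w, R w = α 0 • Φ.mulVec w - (Δt * β 0) • f (x0 + Φ.mulVec w) (t 0)
      + ∑ j ∈ Finset.Icc 1 k,
          (α j • Φ.mulVec (xh j) - (Δt * β j) • f (x0 + Φ.mulVec (xh j)) (t j)))
    (hrank : (C * Φ).rank = Nb) :
    ∃ w : Fin p → ℝ, C.mulVec (R w) = 0 := by
  obtain ⟨v, hv⟩ := mulVec_surjective_of_rank_eq_card (C * Φ) (by simpa using hrank)
    (-C.mulVec (∑ j ∈ Finset.Icc 1 k,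
      (α j • Φ.mulVec (xh j) - (Δt * β j) • f (x0 + Φ.mulVec (xh j)) (t j))))
  refine ⟨(α 0)⁻¹ • v, ?_⟩
  rw [hR, hβ0, mul_zero, zero_smul, sub_zero, Matrix.mulVec_smul, smul_inv_smul₀ hα0,
    Matrix.mulVec_add, Matrix.mulVec_mulVec, hv, neg_add_cancel]
end

section
/- (Sufficient condition for feasibility of conservative LSPG projection: linear velocity.) Assume the velocity is affine in its first argument: f(ξ, t) = A(t) ξ + b(t) with A(t) ∈ ℝ^{N×N} and b(t) ∈ ℝ^N. Given arbitrary previous reduced states x̂^{n−1},…,x̂^{n−k} ∈ ℝ^p, define the linear-multistep residual R(w) := α_0 Φ w − Δt β_0 f(x_0 + Φw, t^n) + Σ_{j=1}^k ( α_j Φ x̂^{n−j} − Δt β_j f(x_0 + Φ x̂^{n−j}, t^{n−j}) ). If rank( C̄ (α_0 I_N − Δt β_0 A(t^n)) Φ ) = N̄, then there exists w ∈ ℝ^p with C̄ R(w) = 0; i.e., the conservative LSPG feasible set is nonempty. -/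
open Matrix Finset

/-- A real matrix of full row rank acts surjectively on vectors. -/
theorem Matrix.mulVec_surjective_of_rank_eq {m n : ℕ} (M : Matrix (Fin m) (Fin n) ℝ)
    (h : M.rank = m) : Function.Surjective M.mulVec := by
  have htop : LinearMap.range M.mulVecLin = ⊤ := by
    apply Submodule.eq_top_of_finrank_eq
    rw [Module.finrank_fin_fun]
    exact h
  exact LinearMap.range_eq_top.mp htop

/-- Sufficient condition for feasibility of conservative LSPG projection with an
affine velocity: if `f(ξ,t) = A(t)ξ + b(t)` and `C̄(α₀ I − Δt β₀ A(tⁿ))Φ` has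
full row rank, then the conservative LSPG feasible set is nonempty. -/
theorem conservative_lspg_feasibility_linear_velocity
    (N Nb p k : ℕ) (hN : 0 < N) (hNb : 0 < Nb) (hp : 0 < p) (hk : 1 ≤ k)
    (Φ : Matrix (Fin N) (Fin p) ℝ) (hΦ : Φᵀ * Φ = 1)
    (C : Matrix (Fin Nb) (Fin N) ℝ)
    (Δt : ℝ) (hΔt : 0 < Δt)
    (α β : ℕ → ℝ)
    (t : ℕ → ℝ) (x0 : Fin N → ℝ)
    (f : (Fin N → ℝ) → ℝ → (Fin N → ℝ))
    (A : ℝ → Matrix (Fin N) (Fin N) ℝ) (b : ℝ → Fin N → ℝ)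
    (hf : ∀ ξ s, f ξ s = (A s).mulVec ξ + b s)
    (xh : ℕ → Fin p → ℝ)
    (R : (Fin p → ℝ) → (Fin N → ℝ))
    (hR : ∀ w, R w = α 0 • Φ.mulVec w - (Δt * β 0) • f (x0 + Φ.mulVec w) (t 0)
      + ∑ j ∈ Finset.Icc 1 k,
          (α j • Φ.mulVec (xh j) - (Δt * β j) • f (x0 + Φ.mulVec (xh j)) (t j)))
    (hrank : (C * (α 0 • (1 : Matrix (Fin N) (Fin N) ℝ) - (Δt * β 0) • A (t 0))
        * Φ).rank = Nb) :
    ∃ w : Fin p → ℝ, C.mulVec (R w) = 0 := by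
  have affine : ∀ w, R w =
      ((α 0 • (1 : Matrix (Fin N) (Fin N) ℝ) - (Δt * β 0) • A (t 0)) * Φ).mulVec w + R 0 := by
    intro w
    simp only [hR, hf, ← Matrix.mulVec_mulVec, Matrix.sub_mulVec, Matrix.smul_mulVec,
      Matrix.one_mulVec, Matrix.mulVec_add, Matrix.mulVec_zero, smul_add, smul_zero]
    abel
  obtain ⟨w, hw⟩ := Matrix.mulVec_surjective_of_rank_eq _ hrank (-C.mulVec (R 0))
  refine ⟨w, ?_⟩
  rw [affine w, Matrix.mulVec_add, Matrix.mulVec_mulVec, ← Matrix.mul_assoc, hw, neg_add_cancel]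
end
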